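/- Let (X_t)_{t≥1} be a real-valued process on a probability space (Ω,𝓕,P) with E(X_t) = 0 for all t, and suppose for some δ ∈ (0,∞) that M := sup_t E|X_t|^{2+δ} < ∞ and Σ_{k=1}^{∞} α_X(k)^{δ/(2+δ)} < ∞. Then, with S_n = X_1 + ⋯ + X_n, the sequence (1/n)·E(S_n²) is bounded: sup_n (1/n)·E(S_n²) ≤ M^{2/(2+δ)} · Σ_{i=−∞}^{∞} α_X(|i|)^{δ/(2+δ)} (up to a universal multiplicative constant coming from Davydov's covariance inequality), where α_X(0) is interpreted as 1/4 (so that |Cov(X_t,X_t)| ≤ E X_t² is covered). -/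

import Mathlib

open MeasureTheory ProbabilityTheory Filter

noncomputable section

/-- The strong mixing (α-mixing) coefficient `α(𝓐,𝓑)` between two sub-σ-algebras:
`sup {|P(A∩B) − P(A)P(B)| : A ∈ 𝓐, B ∈ 𝓑}`. -/
def alphaSig {Ω : Type*} [MeasurableSpace Ω] (P : Measure Ω)
    (𝓐 𝓑 : MeasurableSpace Ω) : ℝ :=
  sSup {x : ℝ | ∃ A B : Set Ω, MeasurableSet[𝓐] A ∧ MeasurableSet[𝓑] B ∧
    x = |(P (A ∩ B)).toReal - (P A).toReal * (P B).toReal|}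

/-- The σ-algebra `σ(X_t : 1 ≤ t < n)` generated by the past of the process up to time `n`. -/
def sigLT {Ω : Type*} (X : ℕ → Ω → ℝ) (n : ℕ) : MeasurableSpace Ω :=
  ⨆ t ∈ {t : ℕ | 1 ≤ t ∧ t < n}, MeasurableSpace.comap (X t) inferInstance

/-- The σ-algebra `σ(X_t : t > m)` generated by the future of the process after time `m`. -/
def sigGT {Ω : Type*} (X : ℕ → Ω → ℝ) (m : ℕ) : MeasurableSpace Ω :=
  ⨆ t ∈ {t : ℕ | m < t}, MeasurableSpace.comap (X t) inferInstance

/-- The strong mixing coefficients `α_X(j) = sup_n α(σ(X_t : t < n), σ(X_t : t > n+j))`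
of a process `(X_t)_{t ≥ 1}`. -/
def mixCoef {Ω : Type*} [MeasurableSpace Ω] (P : Measure Ω) (X : ℕ → Ω → ℝ) (j : ℕ) : ℝ :=
  ⨆ n : ℕ, alphaSig P (sigLT X n) (sigGT X (n + j))

/-- Strict stationarity of the process `(X_t)_{t ≥ 1}`: all finite-dimensional
distributions are shift invariant. -/
def IsStrictlyStationary {Ω : Type*} [MeasurableSpace Ω] (P : Measure Ω)
    (X : ℕ → Ω → ℝ) : Prop :=
  ∀ k m : ℕ, Measure.map (fun ω => fun i : Fin m => X (1 + k + i.1) ω) P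
    = Measure.map (fun ω => fun i : Fin m => X (1 + i.1) ω) P

/-- Covariance of two real random variables. -/
def cov {Ω : Type*} [MeasurableSpace Ω] (P : Measure Ω) (U V : Ω → ℝ) : ℝ :=
  (∫ ω, U ω * V ω ∂P) - (∫ ω, U ω ∂P) * ∫ ω, V ω ∂P

/-- The autocovariance `γ(m) = E[X_1 X_{1+m}]` of a (stationary) process. -/
def acov {Ω : Type*} [MeasurableSpace Ω] (P : Measure Ω) (X : ℕ → Ω → ℝ) (m : ℕ) : ℝ :=
  ∫ ω, X 1 ω * X (1 + m) ω ∂P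

/-- The (truncated) sample autocovariance `γ̂_n(m) = (1/n) ∑_{i=1}^{n-m} X_i X_{i+m}`. -/
def hatGamma {Ω : Type*} (X : ℕ → Ω → ℝ) (n m : ℕ) (ω : Ω) : ℝ :=
  (1 / (n : ℝ)) * ∑ i ∈ Finset.Icc 1 (n - m), X i ω * X (i + m) ω

/-- The (untruncated) sample autocovariance `γ̃_n(m) = (1/n) ∑_{t=1}^{n} X_t X_{t+m}`. -/
def tildeGamma {Ω : Type*} (X : ℕ → Ω → ℝ) (n m : ℕ) (ω : Ω) : ℝ :=
  (1 / (n : ℝ)) * ∑ t ∈ Finset.Icc 1 n, X t ω * X (t + m) ω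

/-- The L²(P)-norm of a real random variable. -/
def l2norm {Ω : Type*} [MeasurableSpace Ω] (P : Measure Ω) (U : Ω → ℝ) : ℝ :=
  Real.sqrt (∫ ω, U ω ^ 2 ∂P)

/-- `σ_{h,k}(l)` of the paper (formulas (2.18) and (2.19); they depend on `n`):
`σ_{h,k}(0) = ∑_{t=1}^n {E(X_t X_{t+h} X_t X_{t+k}) − γ(h)γ(k)}` and, for `l ≥ 1`,
`σ_{h,k}(l) = ∑_{t=1}^{n-l} {E(Y¹ₜ) + E(Y²ₜ) − 2γ(h)γ(k)}` where
`Y¹ₜ = X_t X_{t+h} X_{t+l} X_{t+l+k}` and `Y²ₜ = X_{t+l} X_{t+l+h} X_t X_{t+k}`. -/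
def sigmaHK {Ω : Type*} [MeasurableSpace Ω] (P : Measure Ω) (X : ℕ → Ω → ℝ)
    (h k n l : ℕ) : ℝ :=
  if l = 0 then
    ∑ t ∈ Finset.Icc 1 n,
      ((∫ ω, X t ω * X (t + h) ω * X t ω * X (t + k) ω ∂P) - acov P X h * acov P X k)
  else
    ∑ t ∈ Finset.Icc 1 (n - l),
      ((∫ ω, X t ω * X (t + h) ω * X (t + l) ω * X (t + l + k) ω ∂P)
        + (∫ ω, X (t + l) ω * X (t + l + h) ω * X t ω * X (t + k) ω ∂P)
        - 2 * acov P X h * acov P X k)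

/-- The empirical version `σ̄_{h,k}(l)` of the paper (formulas (2.21) and (2.22)). -/
def sigmaBarHK {Ω : Type*} (X : ℕ → Ω → ℝ) (h k n l : ℕ) (ω : Ω) : ℝ :=
  if l = 0 then
    ∑ _t ∈ Finset.Icc 1 n,
      ((1 / (n : ℝ)) * (∑ i ∈ Finset.Icc 1 n, X i ω * X (i + h) ω * X i ω * X (i + k) ω)
        - tildeGamma X n h ω * tildeGamma X n k ω)
  else
    ∑ _t ∈ Finset.Icc 1 (n - l),
      ((1 / (n : ℝ)) * (∑ i ∈ Finset.Icc 1 n,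
          (X i ω * X (i + h) ω * X (i + l) ω * X (i + l + k) ω
            + X (i + l) ω * X (i + l + h) ω * X i ω * X (i + k) ω))
        - 2 * tildeGamma X n h ω * tildeGamma X n k ω)

/-- `θ_n(h,k) = n·Cov(γ̂_n(h), γ̂_n(k))`. -/
def thetaHat {Ω : Type*} [MeasurableSpace Ω] (P : Measure Ω) (X : ℕ → Ω → ℝ)
    (h k n : ℕ) : ℝ :=
  (n : ℝ) * cov P (hatGamma X n h) (hatGamma X n k)

/-- `θ̃_n(h,k) = n·Cov(γ̃_n(h), γ̃_n(k))`. -/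
def thetaTilde {Ω : Type*} [MeasurableSpace Ω] (P : Measure Ω) (X : ℕ → Ω → ℝ)
    (h k n : ℕ) : ℝ :=
  (n : ℝ) * cov P (tildeGamma X n h) (tildeGamma X n k)

/-- The empirical estimator `θ̄_n(h,k) = (1/n) ∑_{l=0}^{h_n} σ̄_{h,k}(l)` (a random variable). -/
def thetaBar {Ω : Type*} (X : ℕ → Ω → ℝ) (h k hn n : ℕ) (ω : Ω) : ℝ :=
  (1 / (n : ℝ)) * ∑ l ∈ Finset.range (hn + 1), sigmaBarHK X h k n l ω

end

/-- A bounded `m`-measurable factor may be replaced by an `m`-measurable event when it is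
integrated against a centered variable. -/
lemma exists_abs_integral_mul_le {Ω : Type*} {m 𝓕 : MeasurableSpace Ω} (hm : m ≤ 𝓕)
    {P : Measure Ω} [IsProbabilityMeasure P] {U W : Ω → ℝ} {a : ℝ} (hU : Measurable[m] U)
    (hUa : ∀ ω, |U ω| ≤ a) (hW : Integrable W P) (hW0 : ∫ ω, W ω ∂P = 0) :
    ∃ S, MeasurableSet[m] S ∧ |∫ ω, U ω * W ω ∂P| ≤ 2 * a * ∫ ω in S, W ω ∂P := by
  have hUs : StronglyMeasurable[m] U := hU.stronglyMeasurable
  have hUW : Integrable (fun ω => U ω * W ω) P :=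
    hW.bdd_mul (hUs.mono hm).aestronglyMeasurable (Eventually.of_forall hUa)
  have hpull : ∫ ω, U ω * W ω ∂P = ∫ ω, U ω * (P[W|m]) ω ∂P := by
    rw [← integral_condExp hm]
    exact integral_congr_ae (condExp_mul_of_stronglyMeasurable_left hUs hUW hW)
  have hS : MeasurableSet[m] {ω | 0 ≤ (P[W|m]) ω} :=
    stronglyMeasurable_condExp.measurable measurableSet_Ici
  refine ⟨_, hS, ?_⟩
  set S := {ω | 0 ≤ (P[W|m]) ω}
  have hsplit : ∫ ω in S, W ω ∂P + ∫ ω in Sᶜ, W ω ∂P = 0 := by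
    rw [integral_add_compl (hm _ hS) hW, hW0]
  have hpos : ∫ ω in S, |(P[W|m]) ω| ∂P = ∫ ω in S, W ω ∂P := by
    rw [← setIntegral_condExp hm hW hS]
    exact setIntegral_congr_fun (hm _ hS) fun ω hω => abs_of_nonneg hω
  have hneg : ∫ ω in Sᶜ, |(P[W|m]) ω| ∂P = - ∫ ω in Sᶜ, W ω ∂P := by
    rw [← setIntegral_condExp hm hW hS.compl, ← integral_neg]
    exact setIntegral_congr_fun (hm _ hS.compl) fun ω hω => abs_of_neg (not_le.mp hω)
  have hint : Integrable (fun ω => |(P[W|m]) ω|) P := integrable_condExp.abs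
  calc |∫ ω, U ω * W ω ∂P| ≤ ∫ ω, a * |(P[W|m]) ω| ∂P := by
        rw [hpull, ← Real.norm_eq_abs]
        refine norm_integral_le_of_norm_le (hint.const_mul a) (Eventually.of_forall fun ω => ?_)
        rw [Real.norm_eq_abs, abs_mul]
        exact mul_le_mul_of_nonneg_right (hUa ω) (abs_nonneg _)
    _ = 2 * a * ∫ ω in S, W ω ∂P := by
        rw [integral_const_mul, ← integral_add_compl (hm _ hS) hint, hpos, hneg]
        linear_combination (-a) * hsplit

/-- The covariance inequality for bounded variables under strong mixing. -/
lemma abs_cov_le_of_bounded {Ω : Type*} {m₁ m₂ 𝓕 : MeasurableSpace Ω} (h₁ : m₁ ≤ 𝓕)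
    (h₂ : m₂ ≤ 𝓕) {P : Measure Ω} [IsProbabilityMeasure P] {α : ℝ}
    (hα : ∀ A B : Set Ω, MeasurableSet[m₁] A → MeasurableSet[m₂] B →
      |(P (A ∩ B)).toReal - (P A).toReal * (P B).toReal| ≤ α)
    {U V : Ω → ℝ} {a b : ℝ} (hU : Measurable[m₁] U) (hV : Measurable[m₂] V)
    (ha : 0 ≤ a) (hb : 0 ≤ b) (hUa : ∀ ω, |U ω| ≤ a) (hVb : ∀ ω, |V ω| ≤ b) :
    |cov P U V| ≤ 4 * a * b * α := by
  have hUi : Integrable U P := Integrable.of_bound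
    (hU.mono h₁ le_rfl).aestronglyMeasurable a (Eventually.of_forall hUa)
  have hVi : Integrable V P := Integrable.of_bound
    (hV.mono h₂ le_rfl).aestronglyMeasurable b (Eventually.of_forall hVb)
  have hUV : Integrable (fun ω => U ω * V ω) P :=
    hVi.bdd_mul (hU.mono h₁ le_rfl).aestronglyMeasurable (Eventually.of_forall hUa)
  obtain ⟨S, hS, hUS⟩ := exists_abs_integral_mul_le h₁ (P := P) (W := fun ω => V ω - ∫ x, V x ∂P)
    hU hUa (hVi.sub (integrable_const _)) (by
      rw [integral_sub hVi (integrable_const _)]; simp)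
  have hSi : Integrable (S.indicator fun _ => (1 : ℝ)) P :=
    (integrable_const 1).indicator (h₁ _ hS)
  obtain ⟨T, hT, hVT⟩ := exists_abs_integral_mul_le h₂ (P := P)
    (W := fun ω => S.indicator (fun _ => (1 : ℝ)) ω - P.real S)
    hV hVb (hSi.sub (integrable_const _)) (by
      rw [integral_sub hSi (integrable_const _), integral_indicator_const _ (h₁ _ hS)]; simp)
  have hcov : ∫ ω, U ω * (V ω - ∫ x, V x ∂P) ∂P = cov P U V := by
    simp only [mul_sub, cov]
    rw [integral_sub hUV (hUi.mul_const _), integral_mul_const]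
  have hswap : ∫ ω in S, (V ω - ∫ x, V x ∂P) ∂P
      = ∫ ω, V ω * (S.indicator (fun _ => (1 : ℝ)) ω - P.real S) ∂P := by
    have hVS : (fun ω => V ω * S.indicator (fun _ => (1 : ℝ)) ω) = S.indicator V := by
      ext ω; by_cases h : ω ∈ S <;> simp [h]
    simp only [mul_sub]
    rw [integral_sub hVi.integrableOn (integrable_const _), integral_sub _ (hVi.mul_const _), hVS,
      integral_indicator (h₁ _ hS), integral_mul_const, setIntegral_const, smul_eq_mul, mul_comm]
    rw [hVS]
    exact hVi.indicator (h₁ _ hS)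
  have hevent : ∫ ω in T, (S.indicator (fun _ => (1 : ℝ)) ω - P.real S) ∂P
      = (P (S ∩ T)).toReal - (P S).toReal * (P T).toReal := by
    rw [integral_sub hSi.integrableOn (integrable_const _), setIntegral_const,
      integral_indicator_const _ (h₁ _ hS), measureReal_restrict_apply (h₁ _ hS)]
    simp only [Measure.real, smul_eq_mul]
    ring
  rw [hcov, hswap] at hUS
  rw [hevent] at hVT
  calc |cov P U V| ≤ 2 * a * (2 * b * α) := by
        refine hUS.trans (mul_le_mul_of_nonneg_left ?_ (by positivity))
        refine (le_abs_self _).trans (hVT.trans (mul_le_mul_of_nonneg_left ?_ (by positivity)))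
        exact (le_abs_self _).trans (hα S T hS hT)
    _ = 4 * a * b * α := by ring

/-- Truncation of a real number at level `a`. -/
noncomputable def truncAt (a x : ℝ) : ℝ := if |x| ≤ a then x else 0

lemma measurable_truncAt (a : ℝ) : Measurable (truncAt a) :=
  Measurable.ite (measurableSet_le measurable_id.abs measurable_const) measurable_id
    measurable_const

lemma abs_truncAt_le {a : ℝ} (ha : 0 ≤ a) (x : ℝ) : |truncAt a x| ≤ a := by
  unfold truncAt
  split_ifs with h
  · exact h
  · simpa using ha

lemma rpow_le_rpow_sub_mul_rpow {a x q p : ℝ} (ha : 0 < a) (hax : a ≤ x) (hqp : q ≤ p) :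
    x ^ q ≤ a ^ (q - p) * x ^ p := by
  have hx : 0 < x := ha.trans_le hax
  calc x ^ q = x ^ (q - p) * x ^ p := by rw [← Real.rpow_add hx]; ring_nf
    _ ≤ a ^ (q - p) * x ^ p := by
      exact mul_le_mul_of_nonneg_right (Real.rpow_le_rpow_of_nonpos ha hax (by linarith))
        (by positivity)

lemma abs_sub_truncAt_le {a p : ℝ} (ha : 0 < a) (hp : 1 ≤ p) (x : ℝ) :
    |x - truncAt a x| ≤ a ^ (1 - p) * |x| ^ p := by
  unfold truncAt
  split_ifs with h
  · simp only [sub_self, abs_zero]; positivity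
  · simpa using rpow_le_rpow_sub_mul_rpow ha (not_le.mp h).le hp

lemma abs_mul_sub_truncAt_mul_truncAt_le {a p : ℝ} (ha : 0 < a) (hp : 2 ≤ p) (x y : ℝ) :
    |x * y - truncAt a x * truncAt a y| ≤ a ^ (2 - p) * (|x| ^ p + |y| ^ p) := by
  have hmax (h : ¬(|x| ≤ a ∧ |y| ≤ a)) : |x * y| ≤ a ^ (2 - p) * (|x| ^ p + |y| ^ p) := by
    rw [abs_mul]
    have hx := abs_nonneg x
    have hy := abs_nonneg y
    rcases le_total |x| |y| with hxy | hxy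
    · have hay : a ≤ |y| := by
        by_contra! hc
        exact h ⟨by linarith, hc.le⟩
      have key := rpow_le_rpow_sub_mul_rpow ha hay hp
      rw [Real.rpow_two] at key
      have : 0 ≤ a ^ (2 - p) * |x| ^ p := by positivity
      nlinarith
    · have hax : a ≤ |x| := by
        by_contra! hc
        exact h ⟨hc.le, by linarith⟩
      have key := rpow_le_rpow_sub_mul_rpow ha hax hp
      rw [Real.rpow_two] at key
      have : 0 ≤ a ^ (2 - p) * |y| ^ p := by positivity
      nlinarith
  by_cases h : |x| ≤ a ∧ |y| ≤ a
  · simp only [truncAt, h.1, h.2, if_true, sub_self, abs_zero]; positivity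
  · have h0 : truncAt a x * truncAt a y = 0 := by
      unfold truncAt
      rcases not_and_or.mp h with h' | h' <;> simp [h']
    rw [h0, sub_zero]
    exact hmax h

lemma integrable_mul_of_integrable_rpow {Ω : Type*} {𝓕 : MeasurableSpace Ω} {P : Measure Ω}
    [IsProbabilityMeasure P] {U V : Ω → ℝ} {p : ℝ} (hp : 2 ≤ p) (hU : Measurable U)
    (hV : Measurable V) (hUp : Integrable (fun ω => |U ω| ^ p) P)
    (hVp : Integrable (fun ω => |V ω| ^ p) P) : Integrable (fun ω => U ω * V ω) P := by
  refine ((hUp.add hVp).add (integrable_const 1)).mono' (hU.mul hV).aestronglyMeasurable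
    (Eventually.of_forall fun ω => ?_)
  have h := abs_mul_sub_truncAt_mul_truncAt_le one_pos hp (U ω) (V ω)
  rw [Real.one_rpow, one_mul] at h
  have hT : |truncAt 1 (U ω) * truncAt 1 (V ω)| ≤ 1 := by
    rw [abs_mul]
    exact mul_le_one₀ (abs_truncAt_le zero_le_one _) (abs_nonneg _)
      (abs_truncAt_le zero_le_one _)
  have := abs_sub_abs_le_abs_sub (U ω * V ω) (truncAt 1 (U ω) * truncAt 1 (V ω))
  simp only [Real.norm_eq_abs, Pi.add_apply]
  linarith

lemma abs_integral_mul_le_of_truncation {Ω : Type*} {m₁ m₂ 𝓕 : MeasurableSpace Ω} (h₁ : m₁ ≤ 𝓕)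
    (h₂ : m₂ ≤ 𝓕) {P : Measure Ω} [IsProbabilityMeasure P] {α : ℝ}
    (hα : ∀ A B : Set Ω, MeasurableSet[m₁] A → MeasurableSet[m₂] B →
      |(P (A ∩ B)).toReal - (P A).toReal * (P B).toReal| ≤ α)
    {U V : Ω → ℝ} {p M a : ℝ} (hp : 2 ≤ p) (ha : 0 < a)
    (hU : Measurable[m₁] U) (hV : Measurable[m₂] V)
    (hUi : Integrable U P) (hU0 : ∫ ω, U ω ∂P = 0)
    (hUp : Integrable (fun ω => |U ω| ^ p) P) (hVp : Integrable (fun ω => |V ω| ^ p) P)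
    (hUM : ∫ ω, |U ω| ^ p ∂P ≤ M) (hVM : ∫ ω, |V ω| ^ p ∂P ≤ M) :
    |∫ ω, U ω * V ω ∂P| ≤ 4 * a * a * α + 3 * (a ^ (2 - p) * M) := by
  have hU' := hU.mono h₁ le_rfl
  have hV' := hV.mono h₂ le_rfl
  have hTU : Measurable[m₁] fun ω => truncAt a (U ω) := (measurable_truncAt a).comp hU
  have hTV : Measurable[m₂] fun ω => truncAt a (V ω) := (measurable_truncAt a).comp hV
  have hTUa (ω : Ω) : |truncAt a (U ω)| ≤ a := abs_truncAt_le ha.le _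
  have hTVa (ω : Ω) : |truncAt a (V ω)| ≤ a := abs_truncAt_le ha.le _
  have hTUi : Integrable (fun ω => truncAt a (U ω)) P := Integrable.of_bound
    (hTU.mono h₁ le_rfl).aestronglyMeasurable a (Eventually.of_forall hTUa)
  have hTVi : Integrable (fun ω => truncAt a (V ω)) P := Integrable.of_bound
    (hTV.mono h₂ le_rfl).aestronglyMeasurable a (Eventually.of_forall hTVa)
  have hTUV : Integrable (fun ω => truncAt a (U ω) * truncAt a (V ω)) P :=
    hTVi.bdd_mul (hTU.mono h₁ le_rfl).aestronglyMeasurable (Eventually.of_forall hTUa)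
  have hUV := integrable_mul_of_integrable_rpow hp hU' hV' hUp hVp
  have hcov := abs_cov_le_of_bounded h₁ h₂ hα hTU hTV ha.le ha.le hTUa hTVa
  have hprod : |(∫ ω, U ω * V ω ∂P) - ∫ ω, truncAt a (U ω) * truncAt a (V ω) ∂P|
      ≤ a ^ (2 - p) * (2 * M) := by
    rw [← integral_sub hUV hTUV]
    refine (abs_integral_le_integral_abs.trans (integral_mono (hUV.sub hTUV).abs
      ((hUp.add hVp).const_mul (a ^ (2 - p))) fun ω =>
        abs_mul_sub_truncAt_mul_truncAt_le ha hp (U ω) (V ω))).trans ?_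
    rw [integral_const_mul]
    simp only [Pi.add_apply]
    rw [integral_add hUp hVp]
    gcongr
    linarith
  have hEU : |∫ ω, truncAt a (U ω) ∂P| ≤ a ^ (1 - p) * M := by
    have h : ∫ ω, (U ω - truncAt a (U ω)) ∂P = - ∫ ω, truncAt a (U ω) ∂P := by
      rw [integral_sub hUi hTUi, hU0, zero_sub]
    rw [← abs_neg, ← h]
    have hp1 : 1 ≤ p := by linarith
    refine (abs_integral_le_integral_abs.trans (integral_mono (hUi.sub hTUi).abs
      (hUp.const_mul (a ^ (1 - p))) fun ω => abs_sub_truncAt_le ha hp1 (U ω))).trans ?_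
    rw [integral_const_mul]
    gcongr
  have hEV : |∫ ω, truncAt a (V ω) ∂P| ≤ a := by
    simpa using norm_integral_le_of_norm_le_const (μ := P) (f := fun ω => truncAt a (V ω))
      (Eventually.of_forall hTVa)
  have hmeans : |(∫ ω, truncAt a (U ω) ∂P) * ∫ ω, truncAt a (V ω) ∂P| ≤ a ^ (2 - p) * M := by
    rw [abs_mul]
    refine (mul_le_mul hEU hEV (abs_nonneg _) ((abs_nonneg _).trans hEU)).trans (le_of_eq ?_)
    rw [show 2 - p = 1 - p + 1 by ring, Real.rpow_add_one ha.ne']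
    ring
  unfold cov at hcov
  rw [abs_le] at *
  constructor <;> linarith [hcov.1, hcov.2, hprod.1, hprod.2, hmeans.1, hmeans.2]

/-- Davydov's covariance inequality for a pair of variables with a common moment bound, one of
them centered. -/
lemma abs_integral_mul_le_davydov {Ω : Type*} {m₁ m₂ 𝓕 : MeasurableSpace Ω} (h₁ : m₁ ≤ 𝓕)
    (h₂ : m₂ ≤ 𝓕) {P : Measure Ω} [IsProbabilityMeasure P] {α : ℝ}
    (hα : ∀ A B : Set Ω, MeasurableSet[m₁] A → MeasurableSet[m₂] B →
      |(P (A ∩ B)).toReal - (P A).toReal * (P B).toReal| ≤ α)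
    {U V : Ω → ℝ} {p M : ℝ} (hp : 2 < p)
    (hU : Measurable[m₁] U) (hV : Measurable[m₂] V)
    (hUi : Integrable U P) (hU0 : ∫ ω, U ω ∂P = 0)
    (hUp : Integrable (fun ω => |U ω| ^ p) P) (hVp : Integrable (fun ω => |V ω| ^ p) P)
    (hUM : ∫ ω, |U ω| ^ p ∂P ≤ M) (hVM : ∫ ω, |V ω| ^ p ∂P ≤ M) :
    |∫ ω, U ω * V ω ∂P| ≤ 7 * (M ^ (2 / p) * α ^ (1 - 2 / p)) := by
  have hp0 : 0 < p := by linarith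
  have hα0 : 0 ≤ α := (abs_nonneg _).trans
    (hα ∅ ∅ (@MeasurableSet.empty _ m₁) (@MeasurableSet.empty _ m₂))
  have hM0 : 0 ≤ M := (integral_nonneg fun ω => by positivity).trans hUM
  have hθ : 0 < 1 - 2 / p := by
    rw [sub_pos, div_lt_one hp0]; exact hp
  have hpos (β K : ℝ) (hβ : 0 < β) (hK : 0 < K) (hαβ : α ≤ β) (hMK : M ≤ K) :
      |∫ ω, U ω * V ω ∂P| ≤ 7 * (K ^ (2 / p) * β ^ (1 - 2 / p)) := by
    have ha : 0 < (K / β) ^ (1 / p) := by positivity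
    have h := abs_integral_mul_le_of_truncation h₁ h₂ (fun A B hA hB => (hα A B hA hB).trans hαβ)
      hp.le ha hU hV hUi hU0 hUp hVp (hUM.trans hMK) (hVM.trans hMK)
    have hsq : (K / β) ^ (1 / p) * (K / β) ^ (1 / p) * β = K ^ (2 / p) * β ^ (1 - 2 / p) := by
      rw [← Real.rpow_add (by positivity), Real.div_rpow hK.le hβ.le, Real.rpow_sub hβ,
        Real.rpow_one, show 1 / p + 1 / p = 2 / p by ring]
      ring
    have htail : ((K / β) ^ (1 / p)) ^ (2 - p) * K = K ^ (2 / p) * β ^ (1 - 2 / p) := by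
      rw [← Real.rpow_mul (by positivity), show 1 / p * (2 - p) = 2 / p - 1 by field_simp,
        Real.div_rpow hK.le hβ.le, Real.rpow_sub hK, Real.rpow_sub hβ, Real.rpow_sub hβ,
        Real.rpow_one, Real.rpow_one]
      field_simp
    rw [htail] at h
    linarith
  have hlim : Tendsto (fun ε : ℝ => 7 * ((M + ε) ^ (2 / p) * (α + ε) ^ (1 - 2 / p)))
      (nhdsWithin 0 (Set.Ioi 0)) (nhds (7 * (M ^ (2 / p) * α ^ (1 - 2 / p)))) := by
    have hc : Continuous fun ε : ℝ => 7 * ((M + ε) ^ (2 / p) * (α + ε) ^ (1 - 2 / p)) :=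
      continuous_const.mul
        (((continuous_const.add continuous_id).rpow_const fun _ => Or.inr (by positivity)).mul
          ((continuous_const.add continuous_id).rpow_const fun _ => Or.inr hθ.le))
    simpa using (hc.tendsto 0).mono_left nhdsWithin_le_nhds
  refine ge_of_tendsto hlim ?_
  filter_upwards [self_mem_nhdsWithin] with ε hε
  have hε' : 0 < ε := hε
  exact hpos _ _ (by linarith) (by linarith) (by linarith) (by linarith)

lemma abs_measure_inter_sub_le_one {Ω : Type*} [MeasurableSpace Ω] (P : Measure Ω)
    [IsProbabilityMeasure P] (A B : Set Ω) :
    |(P (A ∩ B)).toReal - (P A).toReal * (P B).toReal| ≤ 1 := by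
  change |P.real (A ∩ B) - P.real A * P.real B| ≤ 1
  refine abs_sub_le_of_nonneg_of_le measureReal_nonneg measureReal_le_one (by positivity) ?_
  exact mul_le_one₀ measureReal_le_one measureReal_nonneg measureReal_le_one

lemma alphaSig_nonneg {Ω : Type*} {𝓐 𝓑 𝓕 : MeasurableSpace Ω} (P : Measure Ω) :
    0 ≤ alphaSig P 𝓐 𝓑 := by
  refine Real.sSup_nonneg ?_
  rintro x ⟨A, B, -, -, rfl⟩
  exact abs_nonneg _

lemma mixCoef_nonneg {Ω : Type*} [MeasurableSpace Ω] (P : Measure Ω) (X : ℕ → Ω → ℝ) (j : ℕ) :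
    0 ≤ mixCoef P X j :=
  Real.iSup_nonneg fun _ => alphaSig_nonneg P

lemma abs_measure_inter_sub_le_mixCoef {Ω : Type*} [MeasurableSpace Ω] (P : Measure Ω)
    [IsProbabilityMeasure P] (X : ℕ → Ω → ℝ) (n j : ℕ) {A B : Set Ω}
    (hA : MeasurableSet[sigLT X n] A) (hB : MeasurableSet[sigGT X (n + j)] B) :
    |(P (A ∩ B)).toReal - (P A).toReal * (P B).toReal| ≤ mixCoef P X j := by
  have hle : alphaSig P (sigLT X n) (sigGT X (n + j)) ≤ mixCoef P X j := by
    refine le_ciSup (f := fun n => alphaSig P (sigLT X n) (sigGT X (n + j))) ⟨1, ?_⟩ n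
    rintro x ⟨k, rfl⟩
    refine Real.sSup_le ?_ zero_le_one
    rintro x ⟨A, B, -, -, rfl⟩
    exact abs_measure_inter_sub_le_one P A B
  have hbdd : BddAbove {x : ℝ | ∃ A B : Set Ω, MeasurableSet[sigLT X n] A ∧
      MeasurableSet[sigGT X (n + j)] B ∧
      x = |(P (A ∩ B)).toReal - (P A).toReal * (P B).toReal|} := by
    refine ⟨1, ?_⟩
    rintro x ⟨A, B, -, -, rfl⟩
    exact abs_measure_inter_sub_le_one P A B
  exact (le_csSup hbdd ⟨A, B, hA, hB, rfl⟩).trans hle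

/-- Summing a nonnegative function of the lag over a window costs at most twice its total. -/
lemma sum_lag_le_two_mul_tsum {g : ℕ → ℝ} (hg : ∀ k, 0 ≤ g k) (hsum : Summable g) (n s : ℕ) :
    ∑ t ∈ Finset.Icc 1 n, g ((s - t) + (t - s)) ≤ 2 * ∑' k, g k := by
  rw [← Finset.sum_filter_add_sum_filter_not _ (fun t => t ≤ s), two_mul]
  refine add_le_add ?_ ?_
  · rw [← Finset.sum_image (g := fun t => (s - t) + (t - s)) (f := g)]
    · exact hsum.sum_le_tsum _ fun k _ => hg k
    · intro t ht u hu h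
      simp only [Finset.coe_filter, Finset.mem_Icc, Set.mem_ofPred_eq] at ht hu
      dsimp only at h
      omega
  · rw [← Finset.sum_image (g := fun t => (s - t) + (t - s)) (f := g)]
    · exact hsum.sum_le_tsum _ fun k _ => hg k
    · intro t ht u hu h
      simp only [Finset.coe_filter, Finset.mem_Icc, Set.mem_ofPred_eq] at ht hu
      dsimp only at h
      omega

lemma integral_sum_sq_le {Ω : Type*} [MeasurableSpace Ω] {P : Measure Ω} {X : ℕ → Ω → ℝ}
    {g : ℕ → ℝ} {K : ℝ} (hK : 0 ≤ K) (hg : ∀ k, 0 ≤ g k) (hsum : Summable g)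
    (hint : ∀ s t, 1 ≤ s → 1 ≤ t → Integrable (fun ω => X s ω * X t ω) P)
    (hle : ∀ s k, 1 ≤ s → |∫ ω, X s ω * X (s + k) ω ∂P| ≤ K * g k) (n : ℕ) :
    ∫ ω, (∑ t ∈ Finset.Icc 1 n, X t ω) ^ 2 ∂P ≤ n * (K * (2 * ∑' k, g k)) := by
  have hlag (s t : ℕ) (hs : 1 ≤ s) (ht : 1 ≤ t) :
      ∫ ω, X s ω * X t ω ∂P ≤ K * g ((s - t) + (t - s)) := by
    rcases le_total s t with h | h
    · obtain ⟨k, rfl⟩ := Nat.exists_eq_add_of_le h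
      simpa using (le_abs_self _).trans (hle s k hs)
    · obtain ⟨k, rfl⟩ := Nat.exists_eq_add_of_le h
      simpa [mul_comm] using (le_abs_self _).trans (hle t k ht)
  have hexp : ∫ ω, (∑ t ∈ Finset.Icc 1 n, X t ω) ^ 2 ∂P
      = ∑ s ∈ Finset.Icc 1 n, ∑ t ∈ Finset.Icc 1 n, ∫ ω, X s ω * X t ω ∂P := by
    simp only [sq, Finset.sum_mul_sum]
    have hi (s t : ℕ) (hs : s ∈ Finset.Icc 1 n) (ht : t ∈ Finset.Icc 1 n) :
        Integrable (fun ω => X s ω * X t ω) P :=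
      hint s t (Finset.mem_Icc.mp hs).1 (Finset.mem_Icc.mp ht).1
    rw [integral_finsetSum _ fun s hs => integrable_finsetSum _ fun t ht => hi s t hs ht]
    exact Finset.sum_congr rfl fun s hs => integral_finsetSum _ fun t ht => hi s t hs ht
  rw [hexp]
  calc _ ≤ ∑ s ∈ Finset.Icc 1 n, K * (2 * ∑' k, g k) := by
        refine Finset.sum_le_sum fun s hs => ?_
        refine le_trans (Finset.sum_le_sum fun t ht =>
          hlag s t (Finset.mem_Icc.mp hs).1 (Finset.mem_Icc.mp ht).1) ?_
        rw [← Finset.mul_sum]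
        exact mul_le_mul_of_nonneg_left (sum_lag_le_two_mul_tsum hg hsum n s) hK
    _ = n * (K * (2 * ∑' k, g k)) := by simp

/-- A bound on the correlation at lag `k`, up to the moment factor: `sigLT` and `sigGT` both omit
the boundary index, so lag `k` is controlled by the mixing coefficient at `k - 2`. -/
noncomputable def lagBound (c : ℕ → ℝ) : ℕ → ℝ
  | 0 => 7
  | 1 => 7
  | 2 => 7
  | k + 3 => 7 * c k

lemma abs_integral_mul_le_lagBound {Ω : Type*} {𝓕 : MeasurableSpace Ω} {P : Measure Ω}
    [IsProbabilityMeasure P] {X : ℕ → Ω → ℝ} {p M : ℝ} (hp : 2 < p)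
    (hX : ∀ t, Measurable (X t))
    (h0 : ∀ t, 1 ≤ t → Integrable (X t) P ∧ (∫ ω, X t ω ∂P) = 0)
    (hM : ∀ t, 1 ≤ t → Integrable (fun ω => |X t ω| ^ p) P ∧ (∫ ω, |X t ω| ^ p ∂P) ≤ M)
    (s k : ℕ) (hs : 1 ≤ s) :
    |∫ ω, X s ω * X (s + k) ω ∂P|
      ≤ M ^ (2 / p) * lagBound (fun k => mixCoef P X (k + 1) ^ (1 - 2 / p)) k := by
  have hsk : 1 ≤ s + k := by omega
  have htriv : |∫ ω, X s ω * X (s + k) ω ∂P| ≤ M ^ (2 / p) * 7 := by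
    have h := abs_integral_mul_le_davydov le_rfl le_rfl
      (fun A B _ _ => abs_measure_inter_sub_le_one P A B) hp (hX s) (hX (s + k)) (h0 s hs).1
      (h0 s hs).2 (hM s hs).1 (hM _ hsk).1 (hM s hs).2 (hM _ hsk).2
    rwa [Real.one_rpow, mul_one, mul_comm] at h
  match k with
  | 0 | 1 | 2 => exact htriv
  | k + 3 =>
    have hlt : sigLT X (s + 1) ≤ 𝓕 := iSup₂_le fun t _ => (hX t).comap_le
    have hgt : sigGT X (s + 1 + (k + 1)) ≤ 𝓕 := iSup₂_le fun t _ => (hX t).comap_le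
    have hXs : Measurable[sigLT X (s + 1)] (X s) := by
      refine measurable_iff_comap_le.mpr ?_
      exact le_iSup₂_of_le (f := fun t (_ : t ∈ {t : ℕ | 1 ≤ t ∧ t < s + 1}) =>
        MeasurableSpace.comap (X t) inferInstance) s ⟨hs, by omega⟩ le_rfl
    have hXt : Measurable[sigGT X (s + 1 + (k + 1))] (X (s + (k + 3))) := by
      refine measurable_iff_comap_le.mpr ?_
      exact le_iSup₂_of_le (f := fun t (_ : t ∈ {t : ℕ | s + 1 + (k + 1) < t}) =>
        MeasurableSpace.comap (X t) inferInstance) (s + (k + 3))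
        (by simp only [Set.mem_ofPred_eq]; omega) le_rfl
    have h := abs_integral_mul_le_davydov hlt hgt
      (fun A B hA hB => abs_measure_inter_sub_le_mixCoef P X (s + 1) (k + 1) hA hB) hp hXs hXt
      (h0 s hs).1 (h0 s hs).2 (hM s hs).1 (hM _ hsk).1 (hM s hs).2 (hM _ hsk).2
    simp only [lagBound]
    linarith

lemma lagBound_nonneg {c : ℕ → ℝ} (hc : ∀ k, 0 ≤ c k) : ∀ k, 0 ≤ lagBound c k
  | 0 | 1 | 2 => by norm_num [lagBound]
  | k + 3 => mul_nonneg (by norm_num) (hc k)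

lemma hasSum_lagBound {c : ℕ → ℝ} (hc : Summable c) :
    HasSum (lagBound c) (21 + 7 * ∑' k, c k) := by
  rw [← hasSum_nat_add_iff' 3]
  have h : 21 + 7 * ∑' k, c k - ∑ i ∈ Finset.range 3, lagBound c i = 7 * ∑' k, c k := by
    norm_num [Finset.sum_range_succ, lagBound]
  rw [h]
  exact hc.hasSum.mul_left 7

/-- **Lemma 2 (boundedness form).** For a zero-mean process `(X_t)_{t≥1}` with
`M = sup_t E|X_t|^{2+δ} < ∞` and `∑_k α_X(k)^{δ/(2+δ)} < ∞`, the sequence `E(S_n²)/n` is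
bounded by `M^{2/(2+δ)} ∑_{i=-∞}^{∞} α_X(|i|)^{δ/(2+δ)}` up to a universal multiplicative
constant, where `α_X(0)` is interpreted as `1/4`. -/
theorem partial_sum_variance_bound :
    ∃ C : ℝ, 0 < C ∧
      ∀ (δ : ℝ), 0 < δ →
      ∀ (Ω : Type) (𝓕 : MeasurableSpace Ω) (P : @Measure Ω 𝓕),
        @IsProbabilityMeasure Ω 𝓕 P →
        ∀ (X : ℕ → Ω → ℝ) (M : ℝ),
          (∀ t, @Measurable Ω ℝ 𝓕 _ (X t)) →
          (∀ t, 1 ≤ t → Integrable (X t) P ∧ (∫ ω, X t ω ∂P) = 0) →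
          (∀ t, 1 ≤ t → Integrable (fun ω => |X t ω| ^ (2 + δ)) P ∧
            (∫ ω, |X t ω| ^ (2 + δ) ∂P) ≤ M) →
          Summable (fun k : ℕ => @mixCoef Ω 𝓕 P X (k + 1) ^ (δ / (2 + δ))) →
          ∀ n : ℕ, 1 ≤ n →
            (1 / (n : ℝ)) * ∫ ω, (∑ t ∈ Finset.Icc 1 n, X t ω) ^ 2 ∂P ≤
              C * M ^ (2 / (2 + δ)) *
                (((1 : ℝ) / 4) ^ (δ / (2 + δ))
                  + 2 * ∑' k : ℕ, @mixCoef Ω 𝓕 P X (k + 1) ^ (δ / (2 + δ))) := by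
  refine ⟨168, by norm_num, ?_⟩
  intro δ hδ Ω 𝓕 P hP X M hX h0 hM hsum n hn
  have hexp : δ / (2 + δ) = 1 - 2 / (2 + δ) := by field_simp; ring
  have hK : 0 ≤ M ^ (2 / (2 + δ)) := Real.rpow_nonneg
    ((integral_nonneg fun ω => by positivity).trans (hM 1 le_rfl).2) _
  have hc (k : ℕ) : 0 ≤ mixCoef P X (k + 1) ^ (δ / (2 + δ)) :=
    Real.rpow_nonneg (mixCoef_nonneg P X _) _
  have hlag := hasSum_lagBound hsum
  have hle := abs_integral_mul_le_lagBound (p := 2 + δ) (by linarith) hX h0 hM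
  rw [← hexp] at hle
  have hbound := integral_sum_sq_le hK (lagBound_nonneg hc) hlag.summable
    (fun s t hs ht => integrable_mul_of_integrable_rpow (by linarith) (hX s) (hX t)
      (hM s hs).1 (hM t ht).1) hle n
  rw [hlag.tsum_eq] at hbound
  have hquarter : (1 / 4 : ℝ) ≤ (1 / 4 : ℝ) ^ (δ / (2 + δ)) := by
    have hexp_le : δ / (2 + δ) ≤ 1 := by
      rw [div_le_one (by linarith)]; linarith
    simpa using Real.rpow_le_rpow_of_exponent_ge (x := (1 / 4 : ℝ)) (by norm_num) (by norm_num)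
      hexp_le
  have htsum : 0 ≤ ∑' k : ℕ, mixCoef P X (k + 1) ^ (δ / (2 + δ)) := tsum_nonneg hc
  have hn0 : (0 : ℝ) < n := by exact_mod_cast hn
  rw [one_div, inv_mul_le_iff₀ hn0]
  refine hbound.trans (mul_le_mul_of_nonneg_left ?_ hn0.le)
  rw [mul_comm (168 : ℝ), mul_assoc]
  exact mul_le_mul_of_nonneg_left (by linarith) hK
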